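/- Let G be a connected rayless graph. Then either G has no connected weak twin, or there exist infinitely many pairwise non-isomorphic connected graphs each of which is a weak twin of G. -/

import Mathlib

/-- A graph is rayless if it contains no ray, i.e. no infinite sequence of distinct
vertices `v₀, v₁, v₂, …` with `vᵢ` adjacent to `vᵢ₊₁` for all `i`. -/
def SimpleGraph.IsRayless {V : Type*} (G : SimpleGraph V) : Prop :=
  ¬ ∃ f : ℕ → V, Function.Injective f ∧ ∀ n, G.Adj (f n) (f (n + 1))

/-- Two graphs are weak twins if they are non-isomorphic and there are injective
graph homomorphisms in both directions. -/
def SimpleGraph.WeakTwins {V W : Type*} (G : SimpleGraph V) (H : SimpleGraph W) : Prop :=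
  ¬ Nonempty (G ≃g H) ∧ (∃ f : G →g H, Function.Injective f) ∧
    (∃ g : H →g G, Function.Injective g)

universe u

set_option linter.unusedVariables false
set_option linter.unusedSectionVars false

namespace RT

/-- Vertex-labelled graphs. -/
structure LG (L : Type u) where
  V : Type u
  G : SimpleGraph V
  lab : V → L

section basics

variable {L : Type u} [PartialOrder L]

def IsEmb (A B : LG L) (f : A.V → B.V) : Prop :=
  Function.Injective f ∧ (∀ x y, A.G.Adj x y → B.G.Adj (f x) (f y)) ∧
    ∀ x, A.lab x ≤ B.lab (f x)

def Le (A B : LG L) : Prop := ∃ f, IsEmb A B f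

def IsIso (A B : LG L) (e : A.V ≃ B.V) : Prop :=
  (∀ x y, A.G.Adj x y ↔ B.G.Adj (e x) (e y)) ∧ ∀ x, A.lab x = B.lab (e x)

def Iso (A B : LG L) : Prop := ∃ e, IsIso A B e

def Eqv (A B : LG L) : Prop := Le A B ∧ Le B A

def Conn (A : LG L) : Prop :=
  Nonempty A.V ∧ ∀ x y, Relation.ReflTransGen A.G.Adj x y

theorem IsEmb.comp {A B C : LG L} {g : B.V → C.V} {f : A.V → B.V}
    (hg : IsEmb B C g) (hf : IsEmb A B f) : IsEmb A C (g ∘ f) :=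
  ⟨hg.1.comp hf.1, fun x y h => hg.2.1 _ _ (hf.2.1 _ _ h),
    fun x => (hf.2.2 x).trans (hg.2.2 _)⟩

theorem IsEmb.refl (A : LG L) : IsEmb A A id :=
  ⟨Function.injective_id, fun _ _ h => h, fun _ => le_rfl⟩

theorem IsEmb.iterate {A : LG L} {f : A.V → A.V} (hf : IsEmb A A f) (n : ℕ) :
    IsEmb A A (f^[n]) := by
  induction n with
  | zero => exact IsEmb.refl A
  | succ n ih => exact IsEmb.comp ih hf

theorem Le.refl (A : LG L) : Le A A := ⟨id, IsEmb.refl A⟩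

theorem Le.trans {A B C : LG L} : Le A B → Le B C → Le A C := by
  rintro ⟨f, hf⟩ ⟨g, hg⟩
  exact ⟨g ∘ f, hg.comp hf⟩

theorem IsIso.isEmb {A B : LG L} {e : A.V ≃ B.V} (h : IsIso A B e) : IsEmb A B e :=
  ⟨e.injective, fun x y hxy => (h.1 x y).1 hxy, fun x => (h.2 x).le⟩

theorem IsIso.symm {A B : LG L} {e : A.V ≃ B.V} (h : IsIso A B e) : IsIso B A e.symm :=
  ⟨fun x y => by simpa using (h.1 (e.symm x) (e.symm y)).symm,
    fun x => by simpa using (h.2 (e.symm x)).symm⟩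

theorem IsIso.trans {A B C : LG L} {e : A.V ≃ B.V} {e' : B.V ≃ C.V} (h : IsIso A B e)
    (h' : IsIso B C e') : IsIso A C (e.trans e') :=
  ⟨fun x y => (h.1 x y).trans (h'.1 _ _), fun x => (h.2 x).trans (h'.2 _)⟩

theorem Iso.refl (A : LG L) : Iso A A := ⟨Equiv.refl _, fun _ _ => Iff.rfl, fun _ => rfl⟩

theorem Iso.symm {A B : LG L} : Iso A B → Iso B A := by
  rintro ⟨e, he⟩; exact ⟨_, he.symm⟩

theorem Iso.trans {A B C : LG L} : Iso A B → Iso B C → Iso A C := by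
  rintro ⟨e, he⟩ ⟨f, hf⟩; exact ⟨_, he.trans hf⟩

theorem Iso.le {A B : LG L} : Iso A B → Le A B := by
  rintro ⟨e, he⟩; exact ⟨_, he.isEmb⟩

theorem Iso.eqv {A B : LG L} (h : Iso A B) : Eqv A B := ⟨h.le, h.symm.le⟩

theorem Eqv.refl (A : LG L) : Eqv A A := ⟨Le.refl A, Le.refl A⟩

theorem Eqv.symm {A B : LG L} (h : Eqv A B) : Eqv B A := ⟨h.2, h.1⟩

theorem Eqv.trans {A B C : LG L} (h : Eqv A B) (h' : Eqv B C) : Eqv A C :=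
  ⟨h.1.trans h'.1, h'.2.trans h.2⟩

/-- Disjoint union of a family. -/
def Sg {I : Type u} (U : I → LG L) : LG L where
  V := Σ i, (U i).V
  G :=
    { Adj := fun a b => ∃ i x y, a = ⟨i, x⟩ ∧ b = ⟨i, y⟩ ∧ (U i).G.Adj x y
      symm := ⟨by
        rintro _ _ ⟨i, x, y, rfl, rfl, h⟩
        exact ⟨i, y, x, rfl, rfl, h.symm⟩⟩
      loopless := ⟨by
        rintro _ ⟨i, x, y, rfl, h, h'⟩
        simp only [Sigma.mk.injEq, heq_eq_eq, true_and] at h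
        subst h
        exact h'.ne rfl⟩ }
  lab := fun a => (U a.1).lab a.2

theorem Sg_adj {I : Type u} (U : I → LG L) (i : I) (x y : (U i).V) :
    (Sg U).G.Adj ⟨i, x⟩ ⟨i, y⟩ ↔ (U i).G.Adj x y := by
  constructor
  · rintro ⟨j, x', y', h1, h2, h⟩
    cases h1
    cases h2
    exact h
  · intro h
    exact ⟨i, x, y, rfl, rfl, h⟩

theorem Sg_adj_fst {I : Type u} (U : I → LG L) (a b : (Sg U).V)
    (h : (Sg U).G.Adj a b) : a.1 = b.1 := by
  obtain ⟨i, x, y, rfl, rfl, _⟩ := h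
  rfl

theorem sig_inj {I : Type u} {U : I → LG L} {i : I} {x y : (U i).V}
    (h : (⟨i, x⟩ : Σ i, (U i).V) = ⟨i, y⟩) : x = y := by
  cases h
  rfl

def FS {I J : Type u} (U : I → LG L) (W : J → LG L) (σ : I → J) : Prop :=
  ∃ f : ∀ i, (U i).V → (W (σ i)).V, (∀ i, IsEmb _ _ (f i)) ∧
    ∀ i x i' x', (⟨σ i, f i x⟩ : Σ j, (W j).V) = ⟨σ i', f i' x'⟩ →
      (⟨i, x⟩ : Σ i, (U i).V) = ⟨i', x'⟩

def FLE {I J : Type u} (U : I → LG L) (W : J → LG L) : Prop := ∃ σ, FS U W σ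

theorem hom_fst {I J : Type u} {U : I → LG L} {W : J → LG L} (hU : ∀ i, Conn (U i))
    (g : (Sg U).V → (Sg W).V)
    (hg : ∀ x y, (Sg U).G.Adj x y → (Sg W).G.Adj (g x) (g y)) (i : I) :
    ∃ j, ∀ x : (U i).V, ∃ y : (W j).V, g ⟨i, x⟩ = ⟨j, y⟩ := by
  obtain ⟨⟨x0⟩, hc⟩ := hU i
  refine ⟨(g ⟨i, x0⟩).1, fun x => ?_⟩
  have key : (g ⟨i, x⟩).1 = (g ⟨i, x0⟩).1 := by
    induction hc x0 x with
    | refl => rfl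
    | tail _ h ih =>
      rw [← ih]
      exact (Sg_adj_fst W _ _ (hg _ _ ((Sg_adj U i _ _).2 h))).symm
  rw [← key]
  exact ⟨(g ⟨i, x⟩).2, rfl⟩

theorem FLE_of_Le {I J : Type u} {U : I → LG L} {W : J → LG L} (hU : ∀ i, Conn (U i))
    (h : Le (Sg U) (Sg W)) : FLE U W := by
  obtain ⟨g, hg1, hg2, hg3⟩ := h
  choose σ f hf using hom_fst hU g hg2
  refine ⟨σ, f, fun i => ⟨?_, ?_, ?_⟩, ?_⟩
  · intro x y hxy
    have : g ⟨i, x⟩ = g ⟨i, y⟩ := by rw [hf, hf, hxy]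
    exact sig_inj (hg1 this)
  · intro x y hxy
    have := hg2 _ _ ((Sg_adj U i x y).2 hxy)
    rw [hf, hf, Sg_adj] at this
    exact this
  · intro x
    have := hg3 ⟨i, x⟩
    rw [hf] at this
    exact this
  · intro i x i' x' h
    apply hg1
    rw [hf, hf, h]

theorem FLE.le {I J : Type u} {U : I → LG L} {W : J → LG L} (h : FLE U W) :
    Le (Sg U) (Sg W) := by
  obtain ⟨σ, f, hf, hinj⟩ := h
  refine ⟨fun a => ⟨σ a.1, f a.1 a.2⟩, ?_, ?_, ?_⟩
  · rintro ⟨i, x⟩ ⟨i', x'⟩ h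
    exact hinj _ _ _ _ h
  · rintro _ _ ⟨i, x, y, rfl, rfl, h⟩
    exact (Sg_adj W _ _ _).2 ((hf i).2.1 _ _ h)
  · rintro ⟨i, x⟩
    exact (hf i).2.2 x

theorem FS.le {I J : Type u} {U : I → LG L} {W : J → LG L} {σ : I → J} (h : FS U W σ) (i : I) :
    Le (U i) (W (σ i)) := by
  obtain ⟨f, hf, _⟩ := h
  exact ⟨f i, hf i⟩

theorem FLE.trans {I J K : Type u} {U : I → LG L} {W : J → LG L} {X : K → LG L}
    (h : FLE U W) (h' : FLE W X) : FLE U X := by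
  obtain ⟨σ, f, hf, hinj⟩ := h
  obtain ⟨σ', f', hf', hinj'⟩ := h'
  refine ⟨σ' ∘ σ, fun i x => f' _ (f i x), fun i => (hf' _).comp (hf i), ?_⟩
  intro i x i' x' h
  exact hinj _ _ _ _ (hinj' _ _ _ _ h)

theorem FLE.of_inj {I J : Type u} {U : I → LG L} {W : J → LG L} (σ : I → J)
    (hσ : Function.Injective σ) (h : ∀ i, Le (U i) (W (σ i))) : FLE U W := by
  choose f hf using h
  refine ⟨σ, f, hf, ?_⟩
  intro i x i' x' h
  have h1 : i = i' := hσ (congrArg Sigma.fst h)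
  subst h1
  simp only [Sigma.mk.injEq, heq_eq_eq, true_and] at h ⊢
  exact (hf i).1 h

theorem FLE.refl {I : Type u} (U : I → LG L) : FLE U U :=
  FLE.of_inj id Function.injective_id fun _ => Le.refl _

theorem FS.restrict {I J : Type u} {U : I → LG L} {W : J → LG L} {σ : I → J} (h : FS U W σ)
    (p : I → Prop) (q : J → Prop) (hpq : ∀ i, p i → q (σ i)) :
    FLE (fun i : {i // p i} => U i) (fun j : {j // q j} => W j) := by
  obtain ⟨f, hf, hinj⟩ := h
  refine ⟨fun i => ⟨σ i, hpq _ i.2⟩, fun i => f i, fun i => hf i, ?_⟩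
  rintro ⟨i, hi⟩ x ⟨i', hi'⟩ x' h
  have h2 : (⟨σ i, f i x⟩ : Σ j, (W j).V) = ⟨σ i', f i' x'⟩ :=
    congrArg (fun a : (Σ j : {j // q j}, (W j).V) => (⟨a.1.1, a.2⟩ : Σ j, (W j).V)) h
  have h3 := hinj _ _ _ _ h2
  cases h3
  rfl

theorem FLE.sum {I J K : Type u} {U : I → LG L} {W : J → LG L} (h : FLE U W) (X : K → LG L) :
    FLE (Sum.elim U X) (Sum.elim W X) := by
  obtain ⟨σ, f, hf, hinj⟩ := h
  refine ⟨Sum.map σ id, fun a => match a with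
    | Sum.inl i => f i
    | Sum.inr k => id, ?_, ?_⟩
  · rintro (i | k)
    · exact hf i
    · exact IsEmb.refl _
  · rintro (i | k) x (i' | k') x' h
    · have h1 : σ i = σ i' := Sum.inl_injective (congrArg Sigma.fst h)
      have h2 : (⟨σ i, f i x⟩ : Σ j, (W j).V) = ⟨σ i', f i' x'⟩ := by
        rw [Sigma.ext_iff] at h ⊢
        exact ⟨h1, h.2⟩
      have h3 := hinj _ _ _ _ h2
      cases h3
      rfl
    · have := congrArg Sigma.fst h
      simp at this
    · have := congrArg Sigma.fst h
      simp at this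
    · have := congrArg Sigma.fst h
      simp at this
      subst this
      have h' := eq_of_heq (Sigma.mk.inj h).2
      have h'' : x = x' := h'
      rw [h'']

theorem FLE.sum' {I J K : Type u} {U : I → LG L} {W : J → LG L} (h : FLE U W) (X : K → LG L) :
    FLE (Sum.elim X U) (Sum.elim X W) := by
  have h1 : FLE (Sum.elim X U) (Sum.elim U X) :=
    FLE.of_inj Sum.swap (Equiv.sumComm _ _).injective (by rintro (i | i) <;> exact Le.refl _)
  have h2 : FLE (Sum.elim W X) (Sum.elim X W) :=
    FLE.of_inj Sum.swap (Equiv.sumComm _ _).injective (by rintro (i | i) <;> exact Le.refl _)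
  exact (h1.trans (h.sum X)).trans h2

theorem iso_Sg {I J : Type u} {U : I → LG L} {W : J → LG L} (hU : ∀ i, Conn (U i))
    (hW : ∀ j, Conn (W j)) (h : Iso (Sg U) (Sg W)) :
    ∃ e : I ≃ J, ∀ i, Iso (U i) (W (e i)) := by
  obtain ⟨g, hg1, hg2⟩ := h
  choose σ f hf using hom_fst hU g (fun x y h => (hg1 x y).1 h)
  choose τ f' hf' using hom_fst hW g.symm (fun x y h => (hg1 _ _).2 (by simpa using h))
  have h1 : ∀ i, τ (σ i) = i := by
    intro i
    obtain ⟨⟨x⟩, _⟩ := hU i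
    have := g.symm_apply_apply ⟨i, x⟩
    rw [hf, hf'] at this
    exact congrArg Sigma.fst this
  have h2 : ∀ j, σ (τ j) = j := by
    intro j
    obtain ⟨⟨x⟩, _⟩ := hW j
    have := g.apply_symm_apply ⟨j, x⟩
    rw [hf', hf] at this
    exact congrArg Sigma.fst this
  refine ⟨⟨σ, τ, h1, h2⟩, fun i => ?_⟩
  have hb : Function.Bijective (f i) := by
    constructor
    · intro x y hxy
      have : g ⟨i, x⟩ = g ⟨i, y⟩ := by rw [hf, hf, hxy]
      exact sig_inj (g.injective this)
    · intro y
      have h3 := hf' (σ i) y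
      have h4 : ∃ x, g.symm ⟨σ i, y⟩ = ⟨i, x⟩ := by
        rw [h3]
        have := h1 i
        generalize f' (σ i) y = z at *
        clear h3
        revert z
        rw [this]
        intro z
        exact ⟨z, rfl⟩
      obtain ⟨x, hx⟩ := h4
      refine ⟨x, ?_⟩
      have h5 := hf i x
      rw [← hx] at h5
      exact sig_inj (h5.symm.trans (g.apply_symm_apply _))
  refine ⟨Equiv.ofBijective (f i) hb, ?_, ?_⟩
  · intro x y
    have := hg1 ⟨i, x⟩ ⟨i, y⟩
    rw [hf, hf, Sg_adj, Sg_adj] at this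
    exact this
  · intro x
    have := hg2 ⟨i, x⟩
    rw [hf] at this
    exact this

theorem Sg_iso_of_equiv {I J : Type u} {U : I → LG L} {W : J → LG L}
    (e : I ≃ J) (h : ∀ i, Iso (U i) (W (e i))) : Iso (Sg U) (Sg W) := by
  choose f hf using h
  refine ⟨Equiv.sigmaCongr e f, ?_, ?_⟩
  · intro x y
    constructor
    · rintro ⟨i, x, y, rfl, rfl, h⟩
      exact ⟨e i, f i x, f i y, rfl, rfl, ((hf i).1 _ _).1 h⟩
    · intro h
      obtain ⟨i, x⟩ := x
      obtain ⟨i', y⟩ := y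
      have h1 : e i = e i' := Sg_adj_fst _ _ _ h
      have h1 := e.injective h1
      subst h1
      have h2 : (W (e i)).G.Adj (f i x) (f i y) := (Sg_adj W (e i) _ _).1 h
      exact (Sg_adj U i _ _).2 (((hf i).1 _ _).2 h2)
  · rintro ⟨i, x⟩
    exact (hf i).2 x

/-- every labelled graph is the disjoint union of its components -/
theorem exists_comps (X : LG L) : ∃ (I : Type u) (U : I → LG L), (∀ i, Conn (U i)) ∧
    Iso X (Sg U) := by
  let U : X.G.ConnectedComponent → LG L := fun i =>
    ⟨{x // X.G.connectedComponentMk x = i}, X.G.comap Subtype.val, fun x => X.lab x⟩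
  refine ⟨X.G.ConnectedComponent, U, ?_, ?_⟩
  · intro i
    constructor
    · obtain ⟨x, hx⟩ := i.exists_rep
      exact ⟨⟨x, hx⟩⟩
    · rintro ⟨x, hx⟩ ⟨y, hy⟩
      have h1 : X.G.Reachable x y := SimpleGraph.ConnectedComponent.exact (hx.trans hy.symm)
      rw [SimpleGraph.reachable_iff_reflTransGen] at h1
      have key : ∃ hy' : X.G.connectedComponentMk y = i,
          Relation.ReflTransGen (U i).G.Adj ⟨x, hx⟩ ⟨y, hy'⟩ := by
        clear hy
        induction h1 with
        | refl => exact ⟨hx, .refl⟩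
        | @tail b c _ h ih =>
          obtain ⟨hb, ih⟩ := ih
          have hc : X.G.connectedComponentMk c = i := by
            rw [← hb]
            exact SimpleGraph.ConnectedComponent.sound h.symm.reachable
          exact ⟨hc, ih.tail h⟩
      obtain ⟨_, h⟩ := key
      exact h
  · refine ⟨(Equiv.sigmaFiberEquiv X.G.connectedComponentMk).symm, ?_, ?_⟩
    · intro x y
      constructor
      · intro h
        have : X.G.connectedComponentMk x = X.G.connectedComponentMk y :=
          SimpleGraph.ConnectedComponent.sound h.reachable
        refine ⟨X.G.connectedComponentMk y, ⟨x, this⟩, ⟨y, rfl⟩, ?_, rfl, h⟩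
        change (⟨_, ⟨x, rfl⟩⟩ : Σ i, (U i).V) = ⟨_, ⟨x, _⟩⟩
        generalize X.G.connectedComponentMk y = c at this
        subst this
        rfl
      · rintro ⟨i, x', y', h1, h2, h3⟩
        have h1' : x = x'.1 := congrArg (fun a : (Σ i, (U i).V) => a.2.1) h1
        have h2' : y = y'.1 := congrArg (fun a : (Σ i, (U i).V) => a.2.1) h2
        rw [h1', h2']
        exact h3
    · intro x
      rfl

end basics

section families

variable {L : Type u} [PartialOrder L]

def Many (A : LG L) : Prop :=
  ∃ F : ℕ → LG L, (∀ n, Conn (F n) ∧ Eqv (F n) A) ∧ ∀ n m, n ≠ m → ¬ Iso (F n) (F m)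

def FMany (Q : LG L → Prop) {I : Type u} (U : I → LG L) : Prop :=
  ∃ F : ℕ → LG L, (∀ n m, n ≠ m → ¬ Iso (F n) (F m)) ∧
    ∀ n, Eqv (F n) (Sg U) ∧ ∃ (I' : Type u) (T : I' → LG L), F n = Sg T ∧
      ∀ i, Conn (T i) ∧ Q (T i)

theorem fmany_of_many {Q : LG L → Prop} (hQ : ∀ A B, Q A → Le A B → Q B) {I : Type u}
    {U : I → LG L} (hU : ∀ i, Conn (U i)) (hQU : ∀ i, Q (U i)) (i0 : I) (h : Many (U i0)) :
    FMany Q U := by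
  classical
  obtain ⟨X, hX1, hX2⟩ := h
  let T : ℕ → I → LG L := fun n i => if Eqv (U i) (U i0) then X n else U i
  have hT1 : ∀ n i, Eqv (T n i) (U i) := by
    intro n i
    by_cases h : Eqv (U i) (U i0)
    · simp only [T, if_pos h]
      exact (hX1 n).2.trans h.symm
    · simp only [T, if_neg h]
      exact Eqv.refl _
  have hT2 : ∀ n i, Conn (T n i) := by
    intro n i
    by_cases h : Eqv (U i) (U i0)
    · simp only [T, if_pos h]
      exact (hX1 n).1
    · simp only [T, if_neg h]
      exact hU i
  refine ⟨fun n => Sg (T n), ?_, ?_⟩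
  · intro n m hnm hiso
    obtain ⟨e, he⟩ := iso_Sg (hT2 n) (hT2 m) hiso
    have h1 := he i0
    have h2 : T n i0 = X n := by simp only [T, if_pos (Eqv.refl _)]
    by_cases h : Eqv (U (e i0)) (U i0)
    · have h3 : T m (e i0) = X m := by simp only [T, if_pos h]
      rw [h2, h3] at h1
      exact hX2 n m hnm h1
    · have h3 : T m (e i0) = U (e i0) := by simp only [T, if_neg h]
      rw [h2, h3] at h1
      exact h (h1.symm.eqv.trans (hX1 n).2)
  · intro n
    refine ⟨⟨FLE.le (FLE.of_inj id Function.injective_id fun i => (hT1 n i).1),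
      FLE.le (FLE.of_inj id Function.injective_id fun i => (hT1 n i).2)⟩, I, T n, rfl, ?_⟩
    intro i
    exact ⟨hT2 n i, hQ _ _ (hQU i) (hT1 n i).2⟩

/-- `N` copies of `C` together with the family `X`. -/
def Ef (C : LG L) (N : Type u) {R : Type u} (X : R → LG L) : N ⊕ R → LG L :=
  Sum.elim (fun _ => C) X

theorem Ef_mono (C : LG L) {N N' R : Type u} (X : R → LG L) (e : N ↪ N') :
    FLE (Ef C N X) (Ef C N' X) :=
  FLE.of_inj (Sum.map e id) (Sum.map_injective.2 ⟨e.injective, Function.injective_id⟩)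
    (by rintro (i | i) <;> exact Le.refl _)

theorem Ef_add (C : LG L) {N N' R : Type u} (X : R → LG L) (P : Type u)
    (h : FLE (Ef C N X) (Ef C N' X)) : FLE (Ef C (P ⊕ N) X) (Ef C (P ⊕ N') X) := by
  have h1 : FLE (Ef C (P ⊕ N) X) (Sum.elim (fun _ : P => C) (Ef C N X)) :=
    FLE.of_inj (Equiv.sumAssoc _ _ _) (Equiv.injective _)
      (by rintro ((i | i) | i) <;> exact Le.refl _)
  have h2 : FLE (Sum.elim (fun _ : P => C) (Ef C N' X)) (Ef C (P ⊕ N') X) :=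
    FLE.of_inj (Equiv.sumAssoc _ _ _).symm (Equiv.injective _)
      (by rintro (i | (i | i)) <;> exact Le.refl _)
  exact (h1.trans (h.sum' _)).trans h2

theorem core (C : LG L) {N N' R : Type u} (X : R → LG L) (hX : ∀ r, ¬ Le (X r) C)
    (h : FLE (Ef C N X) (Ef C N' X)) (hlt : Cardinal.mk N' < Cardinal.mk N) :
    ∃ m0 : ℕ, ∀ k, FLE (Ef C (ULift.{u} (Fin (m0 + k))) X) (Ef C N X) ∧
      FLE (Ef C N X) (Ef C (ULift.{u} (Fin (m0 + k))) X) := by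
  classical
  obtain ⟨emb⟩ := (Cardinal.le_def _ _).1 hlt.le
  rcases finite_or_infinite N' with hfin | hinf
  · -- finitely many copies in the smaller family
    obtain ⟨m0, ⟨e0⟩⟩ := Finite.exists_equiv_fin N'
    have e1 : N' ≃ ULift.{u} (Fin m0) := e0.trans Equiv.ulift.symm
    have hstep : FLE (Ef C (ULift.{u} (Fin 1) ⊕ N') X) (Ef C N' X) := by
      refine FLE.trans ?_ h
      have : Cardinal.mk (ULift.{u} (Fin 1) ⊕ N') ≤ Cardinal.mk N := by
        have h2 := Order.succ_le_of_lt hlt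
        rw [Cardinal.succ_eq_of_lt_aleph0 (Cardinal.lt_aleph0_of_finite N')] at h2
        simpa [add_comm] using h2
      obtain ⟨e⟩ := (Cardinal.le_def _ _).1 this
      exact Ef_mono C X e
    have hall : ∀ k, FLE (Ef C (ULift.{u} (Fin k) ⊕ N') X) (Ef C N' X) := by
      intro k
      induction k with
      | zero =>
        exact Ef_mono C X (Equiv.emptySum _ _).toEmbedding
      | succ k ih =>
        refine FLE.trans ?_ hstep
        refine FLE.trans ?_ (Ef_add C X (ULift.{u} (Fin 1)) ih)
        refine Ef_mono C X (Equiv.toEmbedding ?_)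
        refine Equiv.trans ?_ (Equiv.sumAssoc _ _ _)
        refine Equiv.sumCongr ?_ (Equiv.refl _)
        refine Equiv.ulift.trans ?_
        refine ((finCongr (Nat.add_comm k 1)).trans finSumFinEquiv.symm).trans ?_
        exact Equiv.sumCongr Equiv.ulift.symm Equiv.ulift.symm
    refine ⟨m0, fun k => ⟨?_, ?_⟩⟩
    · refine FLE.trans (FLE.trans ?_ (hall k)) (Ef_mono C X emb)
      refine Ef_mono C X (Equiv.toEmbedding ?_)
      refine Equiv.ulift.trans ?_
      refine ((finCongr (Nat.add_comm m0 k)).trans finSumFinEquiv.symm).trans ?_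
      exact Equiv.sumCongr Equiv.ulift.symm e0.symm
    · refine h.trans (Ef_mono C X ?_)
      refine e0.toEmbedding.trans ?_
      exact (Fin.castLEEmb (Nat.le_add_right m0 k)).trans Equiv.ulift.symm.toEmbedding
  · have hN : Infinite N := Infinite.of_injective emb emb.injective
    obtain ⟨σ, hσ⟩ := h
    have hfinN : ∀ k : ℕ, Nonempty (ULift.{u} (Fin k) ↪ N) := fun k =>
      ⟨Equiv.ulift.toEmbedding.trans (Fin.valEmbedding.trans (Infinite.natEmbedding N))⟩
    by_cases hl : ∃ l : N', Cardinal.mk N' ≤ Cardinal.mk {k : N // σ (Sum.inl k) = Sum.inl l}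
    · obtain ⟨l, hl⟩ := hl
      obtain ⟨e⟩ := (Cardinal.le_def _ _).1 hl
      have h1 := hσ.restrict (fun x => ∃ k : {k : N // σ (Sum.inl k) = Sum.inl l}, x = Sum.inl k.1)
        (fun y => y = Sum.inl l) (by rintro _ ⟨k, rfl⟩; exact k.2)
      have h2 : FLE (fun _ : N' => C) (fun _ : ULift.{u} (Fin 1) => C) := by
        refine FLE.trans (FLE.trans ?_ h1) ?_
        · refine FLE.of_inj (fun n => ⟨Sum.inl (e n).1, e n, rfl⟩) ?_ ?_
          · intro n n' hn
            simp only [Subtype.mk.injEq, Sum.inl.injEq] at hn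
            exact e.injective (Subtype.ext hn)
          · intro n
            exact Le.refl _
        · refine FLE.of_inj (fun _ => ⟨0⟩) ?_ ?_
          · rintro ⟨a, rfl⟩ ⟨b, rfl⟩ _
            rfl
          · rintro ⟨a, rfl⟩
            exact Le.refl _
      refine ⟨1, fun k => ⟨?_, ?_⟩⟩
      · exact Ef_mono C X (hfinN _).some
      · refine FLE.trans ⟨σ, hσ⟩ ((h2.sum X).trans ?_)
        refine Ef_mono C X ?_
        exact Equiv.ulift.toEmbedding.trans
          ((Fin.castLEEmb (Nat.le_add_right 1 k)).trans Equiv.ulift.symm.toEmbedding)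
    · push Not at hl
      refine ⟨0, fun k => ⟨Ef_mono C X (hfinN _).some, ?_⟩⟩
      -- the copies mapped to copies
      let a : Set N := {k | ∃ l, σ (Sum.inl k) = Sum.inl l}
      have ha : Cardinal.mk a ≤ Cardinal.mk N' := by
        have h1 : ∀ l, Nonempty ({k : N // σ (Sum.inl k) = Sum.inl l} ↪ N') := fun l =>
          (Cardinal.le_def _ _).1 (hl l).le
        let f := fun l => (h1 l).some
        have h2 : Cardinal.mk a ≤ Cardinal.mk (N' × N') := by
          let l : a → N' := fun k => k.2.choose
          have hlk : ∀ k : a, σ (Sum.inl k.1) = Sum.inl (l k) := fun k => k.2.choose_spec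
          refine Cardinal.mk_le_of_injective (f := fun k => (l k, f (l k) ⟨k.1, hlk k⟩)) ?_
          intro k k' hk
          simp only [Prod.mk.injEq] at hk
          obtain ⟨h3, h4⟩ := hk
          have h5 : ∀ (l' : N') (hl' : l' = l k) (hh : σ (Sum.inl k'.1) = Sum.inl l'),
              f (l k) ⟨k.1, hlk k⟩ = f l' ⟨k'.1, hh⟩ → k = k' := by
            rintro _ rfl hh h6
            have := (f (l k)).injective h6
            simp only [Subtype.mk.injEq] at this
            exact Subtype.ext this
          exact h5 (l k') h3.symm (hlk k') h4
        refine h2.trans ?_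
        rw [Cardinal.mk_prod, Cardinal.lift_id, Cardinal.mul_eq_self (Cardinal.aleph0_le_mk N')]
      have hac : Cardinal.mk (aᶜ : Set N) = Cardinal.mk N :=
        Cardinal.mk_compl_of_infinite a (ha.trans_lt hlt)
      obtain ⟨e⟩ := Cardinal.eq.1 hac
      have hright : ∀ x : N ⊕ R, (∀ k, x = Sum.inl k → k ∉ a) → ∃ r, σ x = Sum.inr r := by
        rintro (k | r) hx
        · rcases hs : σ (Sum.inl k) with l | r
          · exact absurd ⟨l, hs⟩ (hx k rfl)
          · exact ⟨r, rfl⟩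
        · rcases hs : σ (Sum.inr r) with l | r'
          · have := hσ.le (Sum.inr r)
            rw [hs] at this
            exact absurd this (hX r)
          · exact ⟨r', rfl⟩
      have h1 := hσ.restrict (fun x => ∀ k, x = Sum.inl k → k ∉ a)
        (fun y => ∃ r, y = Sum.inr r) hright
      refine FLE.trans (FLE.trans ?_ h1) ?_
      · refine FLE.of_inj (fun x => ⟨Sum.map (fun n => (e.symm n).1) id x, ?_⟩) ?_ ?_
        · intro k hk
          rcases x with n | r
          · simp only [Sum.map_inl, Sum.inl.injEq] at hk
            rw [← hk]
            exact (e.symm n).2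
          · simp at hk
        · intro x y hxy
          simp only [Subtype.mk.injEq] at hxy
          refine Sum.map_injective.2 ⟨?_, Function.injective_id⟩ hxy
          intro n n' hn
          exact e.symm.injective (Subtype.ext hn)
        · rintro (n | r) <;> exact Le.refl _
      · refine FLE.of_inj (fun y => Sum.inr y.2.choose) ?_ ?_
        · rintro ⟨y, hy⟩ ⟨y', hy'⟩ h
          have h1 := hy.choose_spec
          have h2 := hy'.choose_spec
          simp only [Sum.inr.injEq] at h
          apply Subtype.ext
          change y = y'
          rw [h1, h2, h]
        · rintro ⟨y, hy⟩
          have h1 := hy.choose_spec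
          change Le (Ef C N' X y) (X hy.choose)
          generalize hy.choose = r at h1
          rw [h1]
          exact Le.refl _

theorem count_le (C : LG L) {N N' R S : Type u} (X : R → LG L) (Y : S → LG L)
    (hX : ∀ r, ¬ Iso C (X r)) (hY : ∀ s, ¬ Iso C (Y s))
    (e : (N ⊕ R) ⊕ S ≃ (N' ⊕ R) ⊕ S)
    (he : ∀ i, Iso (Sum.elim (Ef C N X) Y i) (Sum.elim (Ef C N' X) Y (e i))) :
    Nonempty (N ↪ N') := by
  have h1 : ∀ n, ∃ n', e (Sum.inl (Sum.inl n)) = Sum.inl (Sum.inl n') := by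
    intro n
    have h2 : Iso C _ := he (Sum.inl (Sum.inl n))
    rcases h3 : e (Sum.inl (Sum.inl n)) with (n' | r) | s
    · exact ⟨n', rfl⟩
    · rw [h3] at h2
      exact absurd h2 (hX r)
    · rw [h3] at h2
      exact absurd h2 (hY s)
  choose f hf using h1
  refine ⟨f, ?_⟩
  intro n n' h
  have := e.injective ((hf n).trans ((congrArg _ (congrArg _ h)).trans (hf n').symm))
  simpa using this

theorem fmany_of_lt {Q : LG L → Prop} {I J : Type u}
    {U : I → LG L} {W : J → LG L} (hU : ∀ i, Conn (U i)) (hW : ∀ j, Conn (W j))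
    (hQU : ∀ i, Q (U i))
    (tU : ∀ i X, Conn X → Eqv X (U i) → Iso X (U i))
    (tW : ∀ j X, Conn X → Eqv X (W j) → Iso X (W j))
    (h1 : Le (Sg U) (Sg W)) (h2 : Le (Sg W) (Sg U)) (i0 : I)
    (hlt : Cardinal.mk {j // Iso (U i0) (W j)} < Cardinal.mk {i // Iso (U i0) (U i)}) :
    FMany Q U := by
  classical
  set C := U i0 with hC
  let NI := {i // Iso C (U i)}
  let NJ := {j // Iso C (W j)}
  let R := {i // Le C (U i) ∧ ¬ Le (U i) C}
  let RW := {j // Le C (W j) ∧ ¬ Le (W j) C}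
  let S := {i // ¬ Le C (U i)}
  let X : R → LG L := fun r => U r
  let Y : S → LG L := fun s => U s
  have hX : ∀ r : R, ¬ Iso C (X r) := fun r h => r.2.2 h.symm.le
  have hY : ∀ s : S, ¬ Iso C (Y s) := fun s h => s.2 h.le
  obtain ⟨σ, hσ⟩ := FLE_of_Le hU h1
  obtain ⟨τ, hτ⟩ := FLE_of_Le hW h2
  have eU : FLE U (Sum.elim (Ef C NI X) Y) := by
    have hcase : ∀ i, ∃ z : (NI ⊕ R) ⊕ S, Sum.elim (Sum.elim Subtype.val Subtype.val) Subtype.val z = i ∧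
        Le (U i) (Sum.elim (Ef C NI X) Y z) := by
      intro i
      by_cases h : Le C (U i)
      · by_cases h' : Le (U i) C
        · have h3 : Iso (U i) C := tU i0 (U i) (hU i) ⟨h', h⟩
          exact ⟨Sum.inl (Sum.inl ⟨i, h3.symm⟩), rfl, h'⟩
        · exact ⟨Sum.inl (Sum.inr ⟨i, h, h'⟩), rfl, Le.refl _⟩
      · exact ⟨Sum.inr ⟨i, h⟩, rfl, Le.refl _⟩
    choose z hz1 hz2 using hcase
    exact FLE.of_inj z (fun a b hab => by rw [← hz1 a, ← hz1 b, hab]) hz2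
  have eEU : FLE (Ef C NI X) U := by
    refine FLE.of_inj (Sum.elim Subtype.val Subtype.val) ?_ ?_
    · rintro (⟨i, hi⟩ | ⟨i, hi⟩) (⟨j, hj⟩ | ⟨j, hj⟩) hij
      · cases hij; rfl
      · cases hij; exact absurd hi.symm.le hj.2
      · cases hij; exact absurd hj.symm.le hi.2
      · cases hij; rfl
    · rintro (⟨i, hi⟩ | ⟨i, hi⟩)
      · exact hi.le
      · exact Le.refl _
  have eU' : FLE (Sum.elim (Ef C NI X) Y) U := by
    refine FLE.of_inj (Sum.elim (Sum.elim Subtype.val Subtype.val) Subtype.val) ?_ ?_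
    · rintro ((⟨i, hi⟩ | ⟨i, hi⟩) | ⟨i, hi⟩) ((⟨j, hj⟩ | ⟨j, hj⟩) | ⟨j, hj⟩) hij
      · cases hij; rfl
      · cases hij; exact absurd hi.symm.le hj.2
      · cases hij; exact absurd hi.le hj
      · cases hij; exact absurd hj.symm.le hi.2
      · cases hij; rfl
      · cases hij; exact absurd hi.1 hj
      · cases hij; exact absurd hj.le hi
      · cases hij; exact absurd hj.1 hi
      · cases hij; rfl
    · rintro ((⟨i, hi⟩ | ⟨i, hi⟩) | ⟨i, hi⟩)
      · exact hi.le
      · exact Le.refl _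
      · exact Le.refl _
  -- the part above `C`
  have hE : FLE (Ef C NI X) (Ef C NJ X) := by
    have a1 : FLE (Ef C NI X) (fun j : {j // Le C (W j)} => W j) := by
      obtain ⟨ρ, hρ⟩ := eEU.trans ⟨σ, hσ⟩
      have := hρ.restrict (fun _ => True) (fun j => Le C (W j)) (by
        rintro (n | r) _
        · exact hρ.le (Sum.inl n)
        · exact r.2.1.trans (hρ.le (Sum.inr r)))
      refine FLE.trans ?_ this
      exact FLE.of_inj (fun x => ⟨x, trivial⟩) (fun a b h => by simpa using h) fun _ => Le.refl _
    have a2 : FLE (fun j : {j // Le C (W j)} => W j) (Ef C NJ (fun j : RW => W j)) := by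
      have hcase : ∀ j : {j // Le C (W j)}, ∃ z : NJ ⊕ RW,
          Sum.elim Subtype.val Subtype.val z = j.1 ∧
          Le (W j) (Ef C NJ (fun j : RW => W j) z) := by
        rintro ⟨j, h⟩
        by_cases h' : Le (W j) C
        · have h3 : Iso C (W j) := tW j C (hU i0) ⟨h, h'⟩
          exact ⟨Sum.inl ⟨j, h3⟩, rfl, h'⟩
        · exact ⟨Sum.inr ⟨j, h, h'⟩, rfl, Le.refl _⟩
      choose z hz1 hz2 using hcase
      exact FLE.of_inj z (fun a b hab => Subtype.ext (by rw [← hz1 a, ← hz1 b, hab])) hz2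
    have a3 : FLE (fun j : RW => W j) X :=
      hτ.restrict (fun j => Le C (W j) ∧ ¬ Le (W j) C) (fun i => Le C (U i) ∧ ¬ Le (U i) C)
        (fun j hj => ⟨hj.1.trans (hτ.le j), fun h => hj.2 ((hτ.le j).trans h)⟩)
    exact (a1.trans a2).trans (a3.sum' _)
  obtain ⟨m0, hm⟩ := core C X (fun r => r.2.2) hE hlt
  let T : (k : ℕ) → (ULift.{u} (Fin (m0 + k)) ⊕ R) ⊕ S → LG L := fun k =>
    Sum.elim (Ef C (ULift.{u} (Fin (m0 + k))) X) Y
  have hT : ∀ k i, Conn (T k i) ∧ Q (T k i) := by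
    rintro k ((n | r) | s)
    · exact ⟨hU i0, hQU i0⟩
    · exact ⟨hU r, hQU r⟩
    · exact ⟨hU s, hQU s⟩
  have hle : ∀ k k', Iso (Sg (T k)) (Sg (T k')) → k ≤ k' := by
    intro k k' h
    obtain ⟨e, he⟩ := iso_Sg (fun i => (hT k i).1) (fun i => (hT k' i).1) h
    obtain ⟨f⟩ := count_le C X Y hX hY e he
    have := Fintype.card_le_of_embedding f
    simpa using this
  refine ⟨fun k => Sg (T k), ?_, fun k => ⟨⟨?_, ?_⟩, _, T k, rfl, hT k⟩⟩
  · intro n m hnm h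
    exact hnm (le_antisymm (hle _ _ h) (hle _ _ h.symm))
  · exact FLE.le (((hm k).1.sum Y).trans eU')
  · exact FLE.le (eU.trans ((hm k).2.sum Y))

theorem FMany.congr {Q : LG L → Prop} {I J : Type u} {U : I → LG L} {W : J → LG L}
    (h : FMany Q W) (hUW : Eqv (Sg U) (Sg W)) : FMany Q U := by
  obtain ⟨F, h1, h2⟩ := h
  exact ⟨F, h1, fun n => ⟨(h2 n).1.trans hUW.symm, (h2 n).2⟩⟩

theorem family_alternative {Q : LG L → Prop} (hQ : ∀ A B, Q A → Le A B → Q B) {I J : Type u}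
    {U : I → LG L} {W : J → LG L} (hU : ∀ i, Conn (U i)) (hW : ∀ j, Conn (W j))
    (hQU : ∀ i, Q (U i)) (hQW : ∀ j, Q (W j))
    (tU : ∀ i X, Conn X → Eqv (U i) X → ¬ Iso (U i) X → Many (U i))
    (tW : ∀ j X, Conn X → Eqv (W j) X → ¬ Iso (W j) X → Many (W j))
    (hE : Eqv (Sg U) (Sg W)) (hI : ¬ Iso (Sg U) (Sg W)) : FMany Q U := by
  classical
  by_cases c1 : ∃ i, Many (U i)
  · obtain ⟨i, hi⟩ := c1
    exact fmany_of_many hQ hU hQU i hi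
  by_cases c2 : ∃ j, Many (W j)
  · obtain ⟨j, hj⟩ := c2
    exact (fmany_of_many hQ hW hQW j hj).congr hE
  push Not at c1 c2
  have tU' : ∀ i X, Conn X → Eqv X (U i) → Iso X (U i) := by
    intro i X hX h
    by_contra h'
    exact c1 i (tU i X hX h.symm fun h2 => h' h2.symm)
  have tW' : ∀ j X, Conn X → Eqv X (W j) → Iso X (W j) := by
    intro i X hX h
    by_contra h'
    exact c2 i (tW i X hX h.symm fun h2 => h' h2.symm)
  let st : Setoid (LG L) := ⟨Iso, Iso.refl, Iso.symm, Iso.trans⟩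
  have hex : ∃ c : Quotient st, ¬ Nonempty ({i // (⟦U i⟧ : Quotient st) = c} ≃
      {j // (⟦W j⟧ : Quotient st) = c}) := by
    by_contra hcon
    push Not at hcon
    apply hI
    refine Sg_iso_of_equiv (Equiv.ofFiberEquiv (f := fun i => (⟦U i⟧ : Quotient st))
      (g := fun j => (⟦W j⟧ : Quotient st)) (fun c => (hcon c).some)) ?_
    intro i
    have := Equiv.ofFiberEquiv_map (f := fun i => (⟦U i⟧ : Quotient st))
      (g := fun j => (⟦W j⟧ : Quotient st)) (fun c => (hcon c).some) i
    exact (Quotient.exact this : Iso _ _).symm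
  obtain ⟨c, hc⟩ := hex
  induction c using Quotient.inductionOn with
  | _ C =>
    have eI : Cardinal.mk {i // (⟦U i⟧ : Quotient st) = ⟦C⟧} = Cardinal.mk {i // Iso C (U i)} :=
      Cardinal.mk_congr (Equiv.subtypeEquivRight fun i =>
        ⟨fun h => (Quotient.exact h : Iso _ _).symm, fun h => Quotient.sound h.symm⟩)
    have eJ : Cardinal.mk {i // (⟦W i⟧ : Quotient st) = ⟦C⟧} = Cardinal.mk {i // Iso C (W i)} :=
      Cardinal.mk_congr (Equiv.subtypeEquivRight fun i =>
        ⟨fun h => (Quotient.exact h : Iso _ _).symm, fun h => Quotient.sound h.symm⟩)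
    have hne : Cardinal.mk {i // Iso C (U i)} ≠ Cardinal.mk {i // Iso C (W i)} := by
      rw [← eI, ← eJ]
      intro h
      exact hc (Cardinal.eq.1 h)
    have swap : ∀ {K : Type u} (Z : K → LG L) (D : LG L), Iso C D →
        Cardinal.mk {i // Iso C (Z i)} = Cardinal.mk {i // Iso D (Z i)} := by
      intro K Z D hD
      exact Cardinal.mk_congr (Equiv.subtypeEquivRight fun i =>
        ⟨fun h => hD.symm.trans h, fun h => hD.trans h⟩)
    rcases lt_or_gt_of_ne hne with hlt | hlt
    · have hpos : Cardinal.mk {i // Iso C (W i)} ≠ 0 := (lt_of_le_of_lt zero_le hlt).ne'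
      obtain ⟨⟨j0, hj0⟩⟩ := Cardinal.mk_ne_zero_iff.1 hpos
      rw [swap U _ hj0, swap W _ hj0] at hlt
      exact (fmany_of_lt hW hU hQW tW' tU' hE.2 hE.1 j0 hlt).congr hE
    · have hpos : Cardinal.mk {i // Iso C (U i)} ≠ 0 := (lt_of_le_of_lt zero_le hlt).ne'
      obtain ⟨⟨j0, hj0⟩⟩ := Cardinal.mk_ne_zero_iff.1 hpos
      rw [swap U _ hj0, swap W _ hj0] at hlt
      exact fmany_of_lt hU hW hQU tU' tW' hE.1 hE.2 j0 hlt

end families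

section rank

variable {V V' : Type u}

/-- reachability inside `X` -/
def RC (G : SimpleGraph V) (X : Set V) : V → V → Prop :=
  Relation.ReflTransGen (fun a b => G.Adj a b ∧ a ∈ X ∧ b ∈ X)

def SConn (G : SimpleGraph V) (C : Set V) : Prop := ∃ x ∈ C, ∀ y ∈ C, RC G C x y

theorem RC.mono {G : SimpleGraph V} {X Y : Set V} (h : X ⊆ Y) {x y : V} (hxy : RC G X x y) :
    RC G Y x y := by
  induction hxy with
  | refl => exact .refl
  | tail _ hab ih => exact Relation.ReflTransGen.tail ih ⟨hab.1, h hab.2.1, h hab.2.2⟩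

theorem RC.symm {G : SimpleGraph V} {X : Set V} {x y : V} (h : RC G X x y) : RC G X y x := by
  induction h with
  | refl => exact .refl
  | tail _ h ih => exact Relation.ReflTransGen.head ⟨h.1.symm, h.2.2, h.2.1⟩ ih

theorem RC.trans {G : SimpleGraph V} {X : Set V} {x y z : V} (h : RC G X x y)
    (h' : RC G X y z) : RC G X x z := Relation.ReflTransGen.trans h h'

theorem RC.map {G : SimpleGraph V} {G' : SimpleGraph V'} {X : Set V} {X' : Set V'} (f : V' → V)
    (hf : ∀ x y, G'.Adj x y → G.Adj (f x) (f y)) (hX : ∀ x ∈ X', f x ∈ X) {x y : V'}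
    (h : RC G' X' x y) : RC G X (f x) (f y) := by
  induction h with
  | refl => exact .refl
  | tail _ hab ih =>
    exact Relation.ReflTransGen.tail ih ⟨hf _ _ hab.1, hX _ hab.2.1, hX _ hab.2.2⟩

def comp (G : SimpleGraph V) (X : Set V) (x : V) : Set V := {y | RC G X x y}

theorem comp_subset {G : SimpleGraph V} {X : Set V} {x : V} (hx : x ∈ X) : comp G X x ⊆ X := by
  intro y hy
  induction (show RC G X x y from hy) with
  | refl => exact hx
  | tail _ h _ => exact h.2.2

theorem comp_sconn (G : SimpleGraph V) (X : Set V) (x : V) : SConn G (comp G X x) := by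
  refine ⟨x, .refl, fun y hy => ?_⟩
  have hy : RC G X x y := hy
  induction hy with
  | refl => exact .refl
  | tail h1 h2 ih =>
    exact Relation.ReflTransGen.tail (ih h1) ⟨h2.1, h1, Relation.ReflTransGen.tail h1 h2⟩

theorem SConn.rc {G : SimpleGraph V} {Z : Set V} (h : SConn G Z) {x y : V} (hx : x ∈ Z)
    (hy : y ∈ Z) : RC G Z x y := by
  obtain ⟨z, _, hz⟩ := h
  exact (hz x hx).symm.trans (hz y hy)

theorem SConn.subset_comp {G : SimpleGraph V} {Z X : Set V} (h : SConn G Z) (hZX : Z ⊆ X)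
    {x z : V} (hz : z ∈ Z) (hxz : RC G X x z) : Z ⊆ comp G X x := fun _ hy =>
  hxz.trans ((h.rc hz hy).mono hZX)

theorem SConn.image {G : SimpleGraph V} {G' : SimpleGraph V'} (f : V' → V)
    (hf : ∀ x y, G'.Adj x y → G.Adj (f x) (f y)) {Z : Set V'} (h : SConn G' Z) :
    SConn G (f '' Z) := by
  obtain ⟨x, hx, hx'⟩ := h
  refine ⟨f x, ⟨x, hx, rfl⟩, ?_⟩
  rintro _ ⟨y, hy, rfl⟩
  exact (hx' y hy).map f hf fun z hz => Set.mem_image_of_mem f hz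

/-- Schmidt rank of `G[X]` is at most `α`. -/
def R (G : SimpleGraph V) (α : Ordinal.{u}) (X : Set V) : Prop :=
  ∃ S : Set V, S.Finite ∧ ∀ C, SConn G C → C ⊆ X \ S → ∃ β, ∃ _ : β < α, R G β C
termination_by α

theorem R_iff (G : SimpleGraph V) (α : Ordinal.{u}) (X : Set V) :
    R G α X ↔ ∃ S : Set V, S.Finite ∧ ∀ C, SConn G C → C ⊆ X \ S → ∃ β, β < α ∧ R G β C := by
  rw [R]
  simp only [exists_prop]

theorem R_map {G : SimpleGraph V} {G' : SimpleGraph V'} (f : V' → V) (hinj : Function.Injective f)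
    (hf : ∀ x y, G'.Adj x y → G.Adj (f x) (f y)) (α : Ordinal.{u}) :
    ∀ (X : Set V) (X' : Set V'), (∀ x ∈ X', f x ∈ X) → R G α X → R G' α X' := by
  induction α using WellFoundedLT.induction with
  | ind α ih =>
    intro X X' hX h
    rw [R_iff] at h ⊢
    obtain ⟨S, hS, h⟩ := h
    refine ⟨f ⁻¹' S, hS.preimage hinj.injOn, ?_⟩
    intro C hC hCX
    obtain ⟨β, hβ, hR⟩ := h (f '' C) (hC.image f hf) (by
      rintro _ ⟨y, hy, rfl⟩
      exact ⟨hX _ (hCX hy).1, (hCX hy).2⟩)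
    exact ⟨β, hβ, ih β hβ _ _ (fun x hx => Set.mem_image_of_mem f hx) hR⟩

theorem R_subset {G : SimpleGraph V} {α : Ordinal.{u}} {X Y : Set V} (h : R G α X) (hY : Y ⊆ X) :
    R G α Y :=
  R_map id Function.injective_id (fun _ _ h => h) α X Y hY h

def Good (G : SimpleGraph V) (α : Ordinal.{u}) (S : Set V) : Prop :=
  S.Finite ∧ ∀ C, SConn G C → C ⊆ Sᶜ → ∃ β, β < α ∧ R G β C

def IsKer (G : SimpleGraph V) (α : Ordinal.{u}) (S : Set V) : Prop :=
  Good G α S ∧ ∀ S', Good G α S' → S ⊆ S'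

theorem Good.preimage {G : SimpleGraph V} {G' : SimpleGraph V'} (f : V' → V)
    (hinj : Function.Injective f) (hf : ∀ x y, G'.Adj x y → G.Adj (f x) (f y)) {α : Ordinal.{u}}
    {S : Set V} (h : Good G α S) : Good G' α (f ⁻¹' S) := by
  refine ⟨h.1.preimage hinj.injOn, fun C hC hCS => ?_⟩
  obtain ⟨β, hβ, hR⟩ := h.2 (f '' C) (hC.image f hf) (by
    rintro _ ⟨y, hy, rfl⟩
    exact hCS hy)
  exact ⟨β, hβ, R_map f hinj hf β _ _ (fun x hx => Set.mem_image_of_mem f hx) hR⟩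

theorem mem_of_good {G : SimpleGraph V} {α : Ordinal.{u}} {S S' : Set V} {v : V}
    (hS : Good G α S) (hv : v ∈ S) (hn : ¬ Good G α (S \ {v})) (hS' : Good G α S') : v ∈ S' := by
  classical
  by_contra hvS'
  apply hn
  refine ⟨hS.1.subset Set.sdiff_subset, fun E hE hES => ?_⟩
  by_cases hvE : v ∈ E
  swap
  · refine hS.2 E hE fun x hx hxS => hES hx ⟨hxS, ?_⟩
    rintro rfl
    exact hvE hx
  -- component of `v` in `G - S'`
  obtain ⟨βD, hβD, hRD⟩ := hS'.2 (comp G S'ᶜ v) (comp_sconn _ _ _) (comp_subset hvS')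
  rw [R_iff] at hRD
  obtain ⟨SD, hSD, hRD⟩ := hRD
  have hs : ∀ s, ∃ β, β < α ∧ ∃ T : Set V, T.Finite ∧ (s ∉ S → ∀ C, SConn G C →
      C ⊆ comp G Sᶜ s \ T → ∃ γ, γ < β ∧ R G γ C) := by
    intro s
    by_cases h : s ∈ S
    · exact ⟨βD, hβD, ∅, Set.finite_empty, fun h' => absurd h h'⟩
    · obtain ⟨β, hβ, hR⟩ := hS.2 (comp G Sᶜ s) (comp_sconn _ _ _) (comp_subset h)
      rw [R_iff] at hR
      obtain ⟨T, hT, hR⟩ := hR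
      exact ⟨β, hβ, T, hT, fun _ => hR⟩
  choose β hβ T hT hR using hs
  have hfin := hS'.1
  let γ : Ordinal.{u} := max βD (hfin.toFinset.sup β)
  have hγ : γ < α := by
    refine max_lt hβD ?_
    rw [Finset.sup_lt_iff (lt_of_le_of_lt bot_le hβD)]
    exact fun s _ => hβ s
  refine ⟨γ, hγ, ?_⟩
  rw [R_iff]
  refine ⟨{v} ∪ S' ∪ SD ∪ ⋃ s ∈ S', T s, ?_, ?_⟩
  · exact (((Set.finite_singleton v).union hfin).union hSD).union (hfin.biUnion fun s _ => hT s)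
  intro Z hZ hZE
  have hZ1 : ∀ z ∈ Z, z ∈ E ∧ z ≠ v ∧ z ∉ S' ∧ z ∉ SD ∧ ∀ s ∈ S', z ∉ T s := by
    intro z hz
    obtain ⟨h1, h2⟩ := hZE hz
    simp only [Set.mem_union, Set.mem_singleton_iff, Set.mem_iUnion, not_or, not_exists] at h2
    exact ⟨h1, h2.1.1.1, h2.1.1.2, h2.1.2, fun s hs => h2.2 s hs⟩
  have hEv : E \ {v} ⊆ Sᶜ := fun x hx hxS => hES hx.1 ⟨hxS, hx.2⟩
  obtain ⟨z, hz, _⟩ := id hZ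
  obtain ⟨hzE, hzv, hzS', _, _⟩ := hZ1 z hz
  have key : ∀ y, RC G E z y → (∃ s ∈ S', s ∈ E \ {v} ∧ RC G (E \ {v}) z s) ∨ RC G S'ᶜ z v ∨
      (y ∈ E \ {v} ∧ y ∉ S' ∧ RC G ((E \ {v}) ∩ S'ᶜ) z y) := by
    intro y hy
    induction hy with
    | refl => exact Or.inr (Or.inr ⟨⟨hzE, hzv⟩, hzS', .refl⟩)
    | @tail b c _ h ih =>
      rcases ih with ih | ih | ⟨hb, hbS, ih⟩
      · exact Or.inl ih
      · exact Or.inr (Or.inl ih)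
      · by_cases hcv : c = v
        · subst hcv
          exact Or.inr (Or.inl (Relation.ReflTransGen.tail (ih.mono Set.inter_subset_right)
            ⟨h.1, hbS, hvS'⟩))
        · by_cases hcS : c ∈ S'
          · exact Or.inl ⟨c, hcS, ⟨h.2.2, hcv⟩, Relation.ReflTransGen.tail
              (ih.mono Set.inter_subset_left) ⟨h.1, hb, h.2.2, hcv⟩⟩
          · exact Or.inr (Or.inr ⟨⟨h.2.2, hcv⟩, hcS, Relation.ReflTransGen.tail ih
              ⟨h.1, ⟨hb, hbS⟩, ⟨h.2.2, hcv⟩, hcS⟩⟩)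
  rcases key v (hE.rc hzE hvE) with ⟨s, hs, hsE, h⟩ | h | h
  · have hsub := hZ.subset_comp (X := Sᶜ) (fun x hx => hEv ⟨(hZ1 x hx).1, (hZ1 x hx).2.1⟩) hz
      (h.symm.mono hEv)
    obtain ⟨δ, hδ, hRδ⟩ := hR s (hEv hsE) Z hZ
      fun x hx => ⟨hsub hx, (hZ1 x hx).2.2.2.2 s hs⟩
    refine ⟨δ, lt_of_lt_of_le hδ (le_max_of_le_right ?_), hRδ⟩
    exact Finset.le_sup (f := β) (hfin.mem_toFinset.2 hs)
  · have hsub := hZ.subset_comp (X := S'ᶜ) (fun x hx => (hZ1 x hx).2.2.1) hz h.symm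
    obtain ⟨δ, hδ, hRδ⟩ := hRD Z hZ fun x hx => ⟨hsub hx, (hZ1 x hx).2.2.2.1⟩
    exact ⟨δ, lt_of_lt_of_le hδ (le_max_left _ _), hRδ⟩
  · exact absurd rfl h.1.2

theorem exists_ker {G : SimpleGraph V} {α : Ordinal.{u}} (h : R G α Set.univ) :
    ∃ S, IsKer G α S := by
  classical
  have h0 : ∃ n : ℕ, ∃ S, Good G α S ∧ S.ncard = n := by
    rw [R_iff] at h
    obtain ⟨S, hS, h⟩ := h
    exact ⟨_, S, ⟨hS, fun C hC hCS => h C hC fun x hx => ⟨trivial, hCS hx⟩⟩, rfl⟩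
  obtain ⟨S, hS, hn⟩ := Nat.find_spec h0
  refine ⟨S, hS, fun S' hS' v hv => mem_of_good hS hv ?_ hS'⟩
  intro hg
  refine Nat.find_min h0 ?_ ⟨_, hg, rfl⟩
  rw [← hn]
  exact Set.ncard_sdiff_singleton_lt_of_mem hv hS.1

theorem unranked_step {G : SimpleGraph V} {X : Set V} {x : V} (hX : SConn G X) (hx : x ∈ X)
    (hR : ∀ α, ¬ R G α X) : ∃ y Y, G.Adj x y ∧ y ∈ Y ∧ SConn G Y ∧ Y ⊆ X \ {x} ∧
      ∀ α, ¬ R G α Y := by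
  classical
  have h1 : ∃ C, SConn G C ∧ C ⊆ X \ {x} ∧ ∀ α, ¬ R G α C := by
    by_contra hcon
    push Not at hcon
    have h2 : ∀ C : Set V, ∃ α, SConn G C → C ⊆ X \ {x} → R G α C := by
      intro C
      by_cases h : SConn G C ∧ C ⊆ X \ {x}
      · obtain ⟨α, hα⟩ := hcon C h.1 h.2
        exact ⟨α, fun _ _ => hα⟩
      · exact ⟨0, fun h3 h4 => absurd ⟨h3, h4⟩ h⟩
    choose b hb using h2
    refine hR (Order.succ (⨆ C, b C)) ?_
    rw [R_iff]
    refine ⟨{x}, Set.finite_singleton x, fun C hC hCX => ⟨b C, ?_, hb C hC hCX⟩⟩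
    exact Order.lt_succ_of_le (Ordinal.le_iSup b C)
  obtain ⟨C, hC, hCX, hCR⟩ := h1
  obtain ⟨c, hc, _⟩ := id hC
  have key : ∀ y, RC G X c y → (∃ z, G.Adj x z ∧ RC G (X \ {x}) c z) ∨
      (y ≠ x ∧ RC G (X \ {x}) c y) := by
    intro y hy
    induction hy with
    | refl => exact Or.inr ⟨(hCX hc).2, .refl⟩
    | @tail b d _ h ih =>
      rcases ih with ih | ⟨hb, ih⟩
      · exact Or.inl ih
      · by_cases hd : d = x
        · subst hd
          exact Or.inl ⟨b, h.1.symm, ih⟩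
        · exact Or.inr ⟨hd, Relation.ReflTransGen.tail ih ⟨h.1, ⟨h.2.1, hb⟩, h.2.2, hd⟩⟩
  rcases key x (hX.rc (hCX hc).1 hx) with ⟨z, hz1, hz2⟩ | h
  · refine ⟨z, comp G (X \ {x}) c, hz1, hz2, comp_sconn _ _ _, comp_subset (hCX hc), ?_⟩
    intro α hα
    exact hCR α (R_subset hα (hC.subset_comp hCX hc .refl))
  · exact absurd rfl h.1

theorem rayless_ranked {G : SimpleGraph V} (hG : G.IsRayless) (hc : SConn G Set.univ) :
    ∃ α, R G α Set.univ := by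
  classical
  by_contra hcon
  push Not at hcon
  let St := {p : V × Set V // p.1 ∈ p.2 ∧ SConn G p.2 ∧ ∀ α, ¬ R G α p.2}
  have step : ∀ p : St, ∃ q : St, G.Adj p.1.1 q.1.1 ∧ q.1.2 ⊆ p.1.2 \ {p.1.1} := by
    rintro ⟨⟨x, X⟩, h1, h2, h3⟩
    obtain ⟨y, Y, a, b, c, d, e⟩ := unranked_step h2 h1 h3
    exact ⟨⟨⟨y, Y⟩, b, c, e⟩, a, d⟩
  choose nxt hn1 hn2 using step
  obtain ⟨x0, _, _⟩ := id hc
  let p0 : St := ⟨⟨x0, Set.univ⟩, trivial, hc, hcon⟩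
  let s : ℕ → St := fun n => nxt^[n] p0
  have hs : ∀ n, s (n + 1) = nxt (s n) := fun n => Function.iterate_succ_apply' nxt n p0
  have hsub : ∀ n k, (s (n + 1 + k)).1.2 ⊆ (s n).1.2 \ {(s n).1.1} := by
    intro n k
    induction k with
    | zero =>
      rw [Nat.add_zero, hs]
      exact hn2 _
    | succ k ih =>
      rw [← Nat.add_assoc, hs]
      exact (hn2 _).trans (Set.sdiff_subset.trans ih)
  have hne : ∀ n m, n < m → (s n).1.1 ≠ (s m).1.1 := by
    intro n m hnm h
    obtain ⟨k, rfl⟩ := Nat.exists_eq_add_of_le (Nat.succ_le_of_lt hnm)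
    exact (hsub n k (s (n + 1 + k)).2.1).2 h.symm
  refine hG ⟨fun n => (s n).1.1, ?_, ?_⟩
  · intro n m h
    rcases lt_trichotomy n m with h1 | h1 | h1
    · exact absurd h (hne _ _ h1)
    · exact h1
    · exact absurd h.symm (hne _ _ h1)
  · intro n
    change G.Adj (s n).1.1 (s (n + 1)).1.1
    rw [hs]
    exact hn1 _

end rank

section assembly

variable {L : Type u} [PartialOrder L]

theorem rtg_symm {V : Type u} {G : SimpleGraph V} {x y : V} (h : Relation.ReflTransGen G.Adj x y) :
    Relation.ReflTransGen G.Adj y x := by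
  induction h with
  | refl => exact .refl
  | tail _ h ih => exact Relation.ReflTransGen.head h.symm ih

theorem rtg_map {V V' : Type u} {G : SimpleGraph V} {G' : SimpleGraph V'} (f : V → V')
    (hf : ∀ x y, G.Adj x y → G'.Adj (f x) (f y)) {x y : V} (h : Relation.ReflTransGen G.Adj x y) :
    Relation.ReflTransGen G'.Adj (f x) (f y) := by
  induction h with
  | refl => exact .refl
  | tail _ h ih => exact Relation.ReflTransGen.tail ih (hf _ _ h)

theorem Conn.sconn {A : LG L} (h : Conn A) : SConn A.G Set.univ := by
  obtain ⟨⟨x⟩, h⟩ := h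
  refine ⟨x, trivial, fun y _ => ?_⟩
  induction h x y with
  | refl => exact .refl
  | tail _ h ih => exact Relation.ReflTransGen.tail (ih trivial) ⟨h, trivial, trivial⟩

def Rem (A : LG L) {κ : Type u} (e : κ → A.V) : LG (L × Set κ) where
  V := {x // x ∉ Set.range e}
  G := A.G.comap Subtype.val
  lab x := (A.lab x, {k | A.G.Adj (e k) x})

def AsmAdj (K0 : LG L) (U : LG (L × Set K0.V)) : K0.V ⊕ U.V → K0.V ⊕ U.V → Prop
  | .inl k, .inl k' => K0.G.Adj k k'
  | .inl k, .inr x => k ∈ (U.lab x).2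
  | .inr x, .inl k => k ∈ (U.lab x).2
  | .inr x, .inr y => U.G.Adj x y

def Asm (K0 : LG L) (U : LG (L × Set K0.V)) : LG L where
  V := K0.V ⊕ U.V
  G :=
    { Adj := AsmAdj K0 U
      symm := ⟨by
        rintro (k | x) (k' | y) h
        · exact (show K0.G.Adj _ _ from h).symm
        · exact h
        · exact h
        · exact (show U.G.Adj _ _ from h).symm⟩
      loopless := ⟨by
        rintro (k | x) h
        · exact K0.G.loopless.irrefl _ h
        · exact U.G.loopless.irrefl _ h⟩ }
  lab := Sum.elim K0.lab (fun x => (U.lab x).1)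

theorem Asm_emb (K0 : LG L) {U W : LG (L × Set K0.V)} {f : U.V → W.V} (hf : IsEmb U W f) :
    IsEmb (Asm K0 U) (Asm K0 W) (Sum.map id f) := by
  refine ⟨Sum.map_injective.2 ⟨Function.injective_id, hf.1⟩, ?_, ?_⟩
  · rintro (k | x) (k' | y) h
    · exact h
    · exact (hf.2.2 y).2 h
    · exact (hf.2.2 x).2 h
    · exact hf.2.1 _ _ h
  · rintro (k | x)
    · exact le_rfl
    · exact (hf.2.2 x).1

theorem Asm_iso (K0 : LG L) {U W : LG (L × Set K0.V)} (h : Iso U W) :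
    Iso (Asm K0 U) (Asm K0 W) := by
  obtain ⟨e, h1, h2⟩ := h
  refine ⟨Equiv.sumCongr (Equiv.refl _) e, ?_, ?_⟩
  · rintro (k | x) (k' | y)
    · exact Iff.rfl
    · change k ∈ (U.lab y).2 ↔ k ∈ (W.lab (e y)).2
      rw [h2]
    · change k' ∈ (U.lab x).2 ↔ k' ∈ (W.lab (e x)).2
      rw [h2]
    · exact h1 x y
  · rintro (k | x)
    · rfl
    · change (U.lab x).1 = (W.lab (e x)).1
      rw [h2]

theorem Asm_iso_inv (K0 : LG L) {U W : LG (L × Set K0.V)} (e : (Asm K0 U).V ≃ (Asm K0 W).V)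
    (he : IsIso (Asm K0 U) (Asm K0 W) e) (hk : ∀ k, e (Sum.inl k) = Sum.inl k) : Iso U W := by
  have h1 : ∀ x : U.V, ∃ y : W.V, e (Sum.inr x) = Sum.inr y := by
    intro x
    rcases h : e (Sum.inr x) with k | y
    · have := e.injective (h.trans (hk k).symm)
      cases this
    · exact ⟨y, rfl⟩
  choose f hf using h1
  have hb : Function.Bijective f := by
    constructor
    · intro x y hxy
      have : e (Sum.inr x) = e (Sum.inr y) := by rw [hf, hf, hxy]
      exact Sum.inr_injective (e.injective this)
    · intro y
      obtain ⟨z, hz⟩ := e.surjective (Sum.inr y)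
      rcases z with k | x
      · rw [hk] at hz
        cases hz
      · rw [hf] at hz
        exact ⟨x, Sum.inr_injective hz⟩
  refine ⟨Equiv.ofBijective f hb, ?_, ?_⟩
  · intro x y
    have := he.1 (Sum.inr x) (Sum.inr y)
    rw [hf, hf] at this
    exact this
  · intro x
    have h2 := he.2 (Sum.inr x)
    rw [hf] at h2
    refine Prod.ext h2 ?_
    ext k
    have h3 := he.1 (Sum.inl k) (Sum.inr x)
    rw [hf, hk] at h3
    exact h3

theorem Asm_Rem_iso (K0 A : LG L) (e : K0.V → A.V) (he : Function.Injective e)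
    (hadj : ∀ k k', K0.G.Adj k k' ↔ A.G.Adj (e k) (e k')) (hlab : ∀ k, K0.lab k = A.lab (e k)) :
    ∃ φ : (Asm K0 (Rem A e)).V ≃ A.V, IsIso (Asm K0 (Rem A e)) A φ ∧
      ∀ k, φ (Sum.inl k) = e k := by
  let f : K0.V ⊕ (Rem A e).V → A.V := Sum.elim e Subtype.val
  have hb : Function.Bijective f := by
    constructor
    · rintro (k | x) (k' | y) h
      · exact congrArg _ (he h)
      · exact absurd ⟨k, h⟩ y.2
      · exact absurd ⟨k', h.symm⟩ x.2
      · exact congrArg _ (Subtype.ext h)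
    · intro y
      by_cases h : y ∈ Set.range e
      · obtain ⟨k, rfl⟩ := h
        exact ⟨Sum.inl k, rfl⟩
      · exact ⟨Sum.inr ⟨y, h⟩, rfl⟩
  refine ⟨Equiv.ofBijective f hb, ⟨?_, ?_⟩, fun k => rfl⟩
  · rintro (k | x) (k' | y)
    · exact hadj k k'
    · exact Iff.rfl
    · exact A.G.adj_comm _ _
    · exact Iff.rfl
  · rintro (k | x)
    · exact hlab k
    · rfl

theorem Rem_le {A B : LG L} {κ : Type u} {eA : κ → A.V} {eB : κ → B.V} {f : A.V → B.V}
    (hf : IsEmb A B f) (h : ∀ k, f (eA k) = eB k) : Le (Rem A eA) (Rem B eB) := by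
  refine ⟨fun x => ⟨f x.1, ?_⟩, ?_, ?_, ?_⟩
  · rintro ⟨k, hk⟩
    rw [← h] at hk
    exact x.2 ⟨k, hf.1 hk⟩
  · intro x y hxy
    exact Subtype.ext (hf.1 (congrArg Subtype.val hxy))
  · intro x y hxy
    exact hf.2.1 _ _ hxy
  · intro x
    refine ⟨hf.2.2 x.1, ?_⟩
    intro k hk
    change B.G.Adj (eB k) (f x.1)
    rw [← h]
    exact hf.2.1 _ _ hk

def Att {κ : Type u} (X : LG (L × Set κ)) : Prop := ∃ y, (X.lab y).2.Nonempty

theorem Att.mono {κ : Type u} (X Y : LG (L × Set κ)) (h : Att X) (hXY : Le X Y) : Att Y := by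
  obtain ⟨y, k, hk⟩ := h
  obtain ⟨f, hf⟩ := hXY
  exact ⟨f y, k, (hf.2.2 y).2 hk⟩

theorem Rem_att {A : LG L} (hA : Conn A) {κ : Type u} [hκ : Nonempty κ] (e : κ → A.V)
    (x : (Rem A e).V) :
    ∃ y, Relation.ReflTransGen (Rem A e).G.Adj x y ∧ ((Rem A e).lab y).2.Nonempty := by
  obtain ⟨k⟩ := hκ
  obtain ⟨x, hx⟩ := x
  have h := hA.2 x (e k)
  induction h using Relation.ReflTransGen.head_induction_on with
  | refl => exact absurd ⟨k, rfl⟩ hx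
  | @head a c h _ ih =>
    by_cases hc : c ∈ Set.range e
    · obtain ⟨k', rfl⟩ := hc
      exact ⟨⟨a, hx⟩, .refl, k', h.symm⟩
    · obtain ⟨y, hy1, hy2⟩ := ih hc
      have h' : (Rem A e).G.Adj ⟨a, hx⟩ ⟨c, hc⟩ := h
      exact ⟨y, Relation.ReflTransGen.head h' hy1, hy2⟩

theorem comp_att {A : LG L} (hA : Conn A) {κ : Type u} [hκ : Nonempty κ] (e : κ → A.V)
    {I : Type u} {U : I → LG (L × Set κ)} (hU : ∀ i, Conn (U i)) (h : Iso (Rem A e) (Sg U))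
    (i : I) : Att (U i) := by
  obtain ⟨φ, h1, h2⟩ := h
  obtain ⟨⟨x0⟩, _⟩ := hU i
  obtain ⟨y, hy, hl⟩ := Rem_att hA e (φ.symm ⟨i, x0⟩)
  have h3 := rtg_map φ (fun a b h => (h1 a b).1 h) hy
  have h4 : ∀ z : (Sg U).V, Relation.ReflTransGen (Sg U).G.Adj (φ (φ.symm ⟨i, x0⟩)) z → z.1 = i := by
    intro z hz
    induction hz with
    | refl => exact congrArg Sigma.fst (φ.apply_symm_apply _)
    | tail _ h ih => rw [← ih, Sg_adj_fst U _ _ h]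
  have h5 := h4 _ h3
  rw [h2] at hl
  generalize φ y = z at h5 hl
  obtain ⟨j, z⟩ := z
  cases h5
  exact ⟨z, hl⟩

theorem comp_rank {A : LG L} {α : Ordinal.{u}} {κ : Type u} (e : κ → A.V)
    (hg : Good A.G α (Set.range e)) {I : Type u} {U : I → LG (L × Set κ)}
    (hU : ∀ i, Conn (U i)) (h : Iso (Rem A e) (Sg U)) (i : I) :
    ∃ β, β < α ∧ R (U i).G β Set.univ := by
  obtain ⟨φ, h1, h2⟩ := h.symm
  let u : (U i).V → A.V := fun x => (φ ⟨i, x⟩).1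
  have hinj : Function.Injective u := by
    intro x y hxy
    exact sig_inj (φ.injective (Subtype.ext hxy))
  have hadj : ∀ x y, (U i).G.Adj x y → A.G.Adj (u x) (u y) := by
    intro x y hxy
    exact (h1 _ _).1 ((Sg_adj U i x y).2 hxy)
  obtain ⟨β, hβ, hR⟩ := hg.2 (u '' Set.univ) ((hU i).sconn.image u hadj) (by
    rintro _ ⟨x, _, rfl⟩
    exact (φ ⟨i, x⟩).2)
  exact ⟨β, hβ, R_map u hinj hadj β _ _ (fun x hx => Set.mem_image_of_mem u hx) hR⟩

theorem Asm_conn {A : LG L} (hA : Conn A) (K0 : LG L) [hK : Nonempty K0.V] (e : K0.V → A.V)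
    {I : Type u} {T : I → LG (L × Set K0.V)} (hT : ∀ i, Conn (T i)) (hQ : ∀ i, Att (T i))
    (f : A.V → (Asm K0 (Sg T)).V) (hf : IsEmb A (Asm K0 (Sg T)) f)
    (hfe : ∀ k, f (e k) = Sum.inl k) : Conn (Asm K0 (Sg T)) := by
  obtain ⟨k0⟩ := hK
  have h1 : ∀ k, Relation.ReflTransGen (Asm K0 (Sg T)).G.Adj (Sum.inl k) (Sum.inl k0) := by
    intro k
    have := rtg_map f hf.2.1 (hA.2 (e k) (e k0))
    rw [hfe, hfe] at this
    exact this
  have h2 : ∀ z, Relation.ReflTransGen (Asm K0 (Sg T)).G.Adj z (Sum.inl k0) := by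
    rintro (k | ⟨i, x⟩)
    · exact h1 k
    · obtain ⟨y, k, hk⟩ := hQ i
      have h3 : Relation.ReflTransGen (Asm K0 (Sg T)).G.Adj (Sum.inr ⟨i, x⟩) (Sum.inr ⟨i, y⟩) :=
        rtg_map (G := (T i).G) (G' := (Asm K0 (Sg T)).G)
          (fun z => (Sum.inr ⟨i, z⟩ : K0.V ⊕ (Sg T).V))
          (fun a b hab => (Sg_adj T i a b).2 hab) ((hT i).2 x y)
      have h4 : (Asm K0 (Sg T)).G.Adj (Sum.inr ⟨i, y⟩) (Sum.inl k) := hk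
      exact (h3.tail h4).trans (h1 k)
  exact ⟨⟨Sum.inl k0⟩, fun x y => (h2 x).trans (rtg_symm (h2 y))⟩

theorem exists_iterate_id {V : Type u} {K : Set V} (hK : K.Finite) (h : V → V)
    (hinj : Function.Injective h) (hm : ∀ x ∈ K, h x ∈ K) :
    ∃ n : ℕ, ∀ x ∈ K, h^[n + 1] x = x := by
  classical
  haveI := hK.to_subtype
  let p : K → K := fun x => ⟨h x, hm x x.2⟩
  have hp : Function.Injective p := fun x y hxy => Subtype.ext (hinj (congrArg Subtype.val hxy))
  let q : Equiv.Perm K := Equiv.ofBijective p (Finite.injective_iff_bijective.1 hp)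
  have hq : ∀ (k : ℕ) (x : K), ((q ^ k) x).1 = h^[k] x.1 := by
    intro k
    induction k with
    | zero => intro x; rfl
    | succ k ih =>
      intro x
      rw [pow_succ, Equiv.Perm.mul_apply, ih, Function.iterate_succ_apply]
      rfl
  have hpos : 0 < orderOf q := orderOf_pos q
  refine ⟨orderOf q - 1, fun x hx => ?_⟩
  have h1 := hq (orderOf q) ⟨x, hx⟩
  rw [pow_orderOf_eq_one] at h1
  rw [Nat.sub_add_cancel hpos]
  exact h1.symm

end assembly

theorem main (α : Ordinal.{u}) : ∀ (L : Type u) [PartialOrder L] (A B : LG L), Conn A → Conn B →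
    R A.G α Set.univ → Eqv A B → ¬ Iso A B → Many A := by
  classical
  induction α using WellFoundedLT.induction with
  | ind α ih =>
  intro L _ A B hA hB hR hE hI
  by_cases hmin : ∃ β, β < α ∧ R A.G β Set.univ
  · obtain ⟨β, hβ, hRβ⟩ := hmin
    exact ih β hβ L A B hA hB hRβ hE hI
  obtain ⟨K, hK⟩ := exists_ker hR
  have hKne : Nonempty K := by
    by_contra hne
    refine hmin (hK.1.2 Set.univ hA.sconn ?_)
    intro x _ hx
    exact hne ⟨x, hx⟩
  haveI hKfin : Finite K := hK.1.1.to_subtype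
  have hself : ∀ h : A.V → A.V, IsEmb A A h → ∀ x ∈ K, h x ∈ K := fun h hh x hx =>
    hK.2 _ (hK.1.preimage h hh.1 hh.2.1) hx
  obtain ⟨⟨f, hf⟩, g0, hg0⟩ := id hE
  obtain ⟨n, hn⟩ := exists_iterate_id hK.1.1 (g0 ∘ f) (hg0.1.comp hf.1) (hself _ (hg0.comp hf))
  have hg : IsEmb B A ((g0 ∘ f)^[n] ∘ g0) := ((hg0.comp hf).iterate n).comp hg0
  have hgf : ∀ x ∈ K, ((g0 ∘ f)^[n] ∘ g0) (f x) = x := by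
    intro x hx
    have := hn x hx
    rw [Function.iterate_succ_apply] at this
    exact this
  generalize (g0 ∘ f)^[n] ∘ g0 = g at hg hgf
  clear hg0 hn
  let K0 : LG L := ⟨K, A.G.comap Subtype.val, fun k => A.lab k⟩
  haveI : Nonempty K0.V := hKne
  haveI : Finite K0.V := hKfin
  let eA : K0.V → A.V := Subtype.val
  let eB : K0.V → B.V := fun k => f k.1
  have hgB : ∀ k : K0.V, g (eB k) = eA k := fun k => hgf k.1 k.2
  obtain ⟨φA, hφA, hφAk⟩ := Asm_Rem_iso K0 A eA Subtype.val_injective (fun _ _ => Iff.rfl)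
    (fun _ => rfl)
  obtain ⟨φB, hφB, hφBk⟩ := Asm_Rem_iso K0 B eB (hf.1.comp Subtype.val_injective)
    (fun k k' => ⟨fun h => hf.2.1 _ _ h, fun h => by
      have := hg.2.1 _ _ h
      rw [hgB, hgB] at this
      exact this⟩)
    (fun k => le_antisymm (hf.2.2 _) (by
      have := hg.2.2 (eB k)
      rw [hgB] at this
      exact this))
  have hEX : Eqv (Rem A eA) (Rem B eB) := ⟨Rem_le hf fun k => rfl, Rem_le hg hgB⟩
  have hIX : ¬ Iso (Rem A eA) (Rem B eB) := fun h =>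
    hI ((Iso.symm ⟨φA, hφA⟩).trans ((Asm_iso K0 h).trans ⟨φB, hφB⟩))
  obtain ⟨I, U, hU, hXU⟩ := exists_comps (Rem A eA)
  obtain ⟨J, W, hW, hXW⟩ := exists_comps (Rem B eB)
  have hgoodA : Good A.G α (Set.range eA) := by
    have : Set.range eA = K := Subtype.range_val
    rw [this]
    exact hK.1
  have hgoodB : Good B.G α (Set.range eB) := by
    have : Set.range eB = g ⁻¹' K := by
      ext y
      constructor
      · rintro ⟨k, rfl⟩
        change g (eB k) ∈ K
        rw [hgB]
        exact k.2
      · intro hy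
        exact ⟨⟨g y, hy⟩, hg.1 (hgB ⟨g y, hy⟩)⟩
    rw [this]
    exact hK.1.preimage g hg.1 hg.2.1
  have hF : FMany Att U := by
    refine family_alternative (W := W) Att.mono hU hW (comp_att hA eA hU hXU)
      (comp_att hB eB hW hXW) ?_ ?_ ?_ ?_
    · intro i X hX h1 h2
      obtain ⟨β, hβ, hRβ⟩ := comp_rank eA hgoodA hU hXU i
      exact ih β hβ _ _ _ (hU i) hX hRβ h1 h2
    · intro i X hX h1 h2
      obtain ⟨β, hβ, hRβ⟩ := comp_rank eB hgoodB hW hXW i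
      exact ih β hβ _ _ _ (hW i) hX hRβ h1 h2
    · exact (hXU.symm.eqv.trans hEX).trans hXW.eqv
    · intro h
      exact hIX (hXU.trans (h.trans hXW.symm))
  obtain ⟨F, hF1, hF2⟩ := hF
  let Y : ℕ → LG L := fun n => Asm K0 (F n)
  have ha : ∀ n, ∃ a : A.V → (Y n).V, IsEmb A (Y n) a ∧ ∀ k, a (eA k) = Sum.inl k := by
    intro n
    obtain ⟨t, ht⟩ := (hXU.eqv.trans (hF2 n).1.symm).1
    refine ⟨_, (Asm_emb K0 ht).comp hφA.symm.isEmb, fun k => ?_⟩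
    have : φA.symm (eA k) = Sum.inl k :=
      (congrArg φA.symm (hφAk k).symm).trans (φA.symm_apply_apply _)
    exact congrArg (Sum.map id t) this
  have hb : ∀ n, ∃ b : (Y n).V → A.V, IsEmb (Y n) A b ∧ ∀ k, b (Sum.inl k) = eA k := by
    intro n
    obtain ⟨t, ht⟩ := ((hF2 n).1.trans hXU.symm.eqv).1
    exact ⟨_, hφA.isEmb.comp (Asm_emb K0 ht), fun k => hφAk k⟩
  choose a ha1 ha2 using ha
  choose b hb1 hb2 using hb
  have aux : ∀ X : LG (L × Set K0.V), (∃ (I' : Type u) (T : I' → LG (L × Set K0.V)),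
      X = Sg T ∧ ∀ i, Conn (T i) ∧ Att (T i)) → ∀ a' : A.V → (Asm K0 X).V,
      IsEmb A (Asm K0 X) a' → (∀ k, a' (eA k) = Sum.inl k) → Conn (Asm K0 X) := by
    rintro _ ⟨I', T, rfl, hTc⟩ a' h1 h2
    exact Asm_conn hA K0 eA (fun i => (hTc i).1) (fun i => (hTc i).2) a' h1 h2
  have hYc : ∀ n, Conn (Y n) := fun n => aux (F n) (hF2 n).2 (a n) (ha1 n) (ha2 n)
  have hker : ∀ n m (φ : (Y n).V ≃ (Y m).V), IsIso (Y n) (Y m) φ →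
      ∃ p : K0.V → K0.V, ∀ k, φ (Sum.inl k) = Sum.inl (p k) := by
    intro n m φ hφ
    have h1 : ∀ k : K0.V, ∃ k' : K0.V, φ (Sum.inl k) = Sum.inl k' := by
      intro k
      have h2 := hself _ ((hb1 m).comp (hφ.isEmb.comp (ha1 n))) (eA k) k.2
      have h3 : φ (a n (eA k)) = φ (Sum.inl k) := congrArg φ (ha2 n k)
      exact ⟨⟨_, h2⟩, h3.symm.trans ((hb1 m).1 (hb2 m ⟨_, h2⟩).symm)⟩
    choose p hp using h1
    exact ⟨p, hp⟩
  let st : Setoid ℕ := ⟨fun n m => Iso (Y n) (Y m), fun n => Iso.refl _, Iso.symm, Iso.trans⟩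
  have hinf : Infinite (Quotient st) := by
    by_contra hfin
    rw [not_infinite_iff_finite] at hfin
    obtain ⟨c, hc⟩ := Finite.exists_infinite_fiber (fun n : ℕ => (⟦n⟧ : Quotient st))
    induction c using Quotient.inductionOn with
    | _ n0 =>
    have h1 : ∀ n : ((fun n : ℕ => (⟦n⟧ : Quotient st)) ⁻¹' {⟦n0⟧}), ∃ φ : (Y n0).V ≃ (Y n).V,
        IsIso (Y n0) (Y n) φ := by
      rintro ⟨n, hn⟩
      exact (Quotient.exact hn : Iso _ _).symm
    choose φ hφ using h1
    choose p hp using fun n => hker _ _ (φ n) (hφ n)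
    obtain ⟨n, m, hnm, hpe⟩ := Finite.exists_ne_map_eq_of_infinite p
    refine hF1 n m (fun h => hnm (Subtype.ext h)) ?_
    refine Asm_iso_inv K0 ((φ n).symm.trans (φ m)) ((hφ n).symm.trans (hφ m)) ?_
    have hpi : Function.Injective (p n) := by
      intro k k' hk
      have : φ n (Sum.inl k) = φ n (Sum.inl k') :=
        (hp n k).trans ((congrArg Sum.inl hk).trans (hp n k').symm)
      exact Sum.inl_injective ((φ n).injective this)
    intro k
    obtain ⟨k', rfl⟩ := Finite.surjective_of_injective hpi k
    have h2 : (φ n).symm (Sum.inl (p n k')) = Sum.inl k' :=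
      (congrArg (φ n).symm (hp n k').symm).trans ((φ n).symm_apply_apply _)
    have h3 := hp m k'
    rw [← hpe] at h3
    exact (congrArg (φ m) h2).trans h3
  let em := Infinite.natEmbedding (Quotient st)
  refine ⟨fun n => Y (em n).out, fun n => ⟨hYc _, ⟨_, hb1 _⟩, ⟨_, ha1 _⟩⟩, ?_⟩
  intro n m hnm h
  apply hnm
  apply em.injective
  rw [← Quotient.out_eq (em n), ← Quotient.out_eq (em m)]
  exact Quotient.sound h

end RT

/-- A connected rayless graph has either no connected weak twin or infinitely many
pairwise non-isomorphic connected weak twins. -/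
theorem connected_rayless_weakTwin_alternative {V : Type u} (G : SimpleGraph V)
    (hG : G.IsRayless) (hGc : G.Connected) :
    (¬ ∃ (W : Type u) (H : SimpleGraph W), H.Connected ∧ G.WeakTwins H) ∨
    (∃ F : ℕ → Σ W : Type u, SimpleGraph W,
      (∀ i, (F i).2.Connected) ∧
      (∀ i j, i ≠ j → ¬ Nonempty ((F i).2 ≃g (F j).2)) ∧
      ∀ i, G.WeakTwins (F i).2) := by
  classical
  rw [or_iff_not_imp_left, not_not]
  rintro ⟨W, H, hHc, hne, ⟨f, hf⟩, ⟨g, hg⟩⟩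
  let mk : (X : Type u) → SimpleGraph X → RT.LG PUnit.{u + 1} := fun X K => ⟨X, K, fun _ => ⟨⟩⟩
  have hconn : ∀ (X : Type u) (K : SimpleGraph X), K.Connected → RT.Conn (mk X K) := by
    intro X K hK
    refine ⟨hK.nonempty, fun x y => ?_⟩
    exact (SimpleGraph.reachable_iff_reflTransGen x y).1 (hK.preconnected x y)
  have hcG := hconn V G hGc
  obtain ⟨α, hα⟩ := RT.rayless_ranked hG hcG.sconn
  have hM : RT.Many (mk V G) := by
    refine RT.main α _ (mk V G) (mk W H) hcG (hconn W H hHc) hα ⟨?_, ?_⟩ ?_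
    · exact ⟨f, hf, fun _ _ h => f.map_adj h, fun _ => le_rfl⟩
    · exact ⟨g, hg, fun _ _ h => g.map_adj h, fun _ => le_rfl⟩
    · rintro ⟨e, he, _⟩
      exact hne ⟨⟨e, fun {a b} => (he a b).symm⟩⟩
  have hM' : ∃ F : ℕ → RT.LG PUnit.{u + 1}, (∀ n, RT.Conn (F n) ∧ RT.Eqv (F n) (mk V G) ∧
      ¬ RT.Iso (mk V G) (F n)) ∧ ∀ n m, n ≠ m → ¬ RT.Iso (F n) (F m) := by
    obtain ⟨F, h1, h2⟩ := hM
    by_cases h : ∃ n0, RT.Iso (mk V G) (F n0)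
    · obtain ⟨n0, hn0⟩ := h
      refine ⟨fun n => F (n0 + 1 + n), fun n => ⟨(h1 _).1, (h1 _).2, fun h => ?_⟩, ?_⟩
      · exact h2 n0 (n0 + 1 + n) (by omega) (hn0.symm.trans h)
      · intro n m hnm
        exact h2 _ _ (by omega)
    · exact ⟨F, fun n => ⟨(h1 n).1, (h1 n).2, fun h' => h ⟨n, h'⟩⟩, h2⟩
  obtain ⟨F, h1, h2⟩ := hM'
  have hiso : ∀ A B : RT.LG PUnit.{u + 1}, Nonempty (A.G ≃g B.G) → RT.Iso A B := by
    rintro A B ⟨e⟩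
    exact ⟨e.toEquiv, fun x y => e.map_adj_iff.symm, fun _ => rfl⟩
  have hle : ∀ A B : RT.LG PUnit.{u + 1}, RT.Le A B → ∃ f : A.G →g B.G, Function.Injective f := by
    rintro A B ⟨f, h1, h2, _⟩
    exact ⟨⟨f, fun {a b} h => h2 a b h⟩, h1⟩
  refine ⟨fun n => ⟨(F n).V, (F n).G⟩, ?_, ?_, ?_⟩
  · intro n
    haveI := (h1 n).1.1
    exact ⟨fun x y => (SimpleGraph.reachable_iff_reflTransGen x y).2 ((h1 n).1.2 x y)⟩
  · intro i j hij h
    exact h2 i j hij (hiso _ _ h)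
  · intro n
    exact ⟨fun h => (h1 n).2.2 (hiso _ _ h), hle _ _ (h1 n).2.1.2, hle _ _ (h1 n).2.1.1⟩
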